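/- arXiv:math/0009226 — 2 statements merged into one kernel-verified Lean document; each statement's English description precedes it below -/
import Mathlib

section
/- Let x = (x₁,x₂,x₃,x₄) ∈ ℂ⁴ with all x_i ≠ 0 and n = 1 + |x₁|² + |x₂|² + |x₃|² + |x₄|². Then the 2×2 matrix H(x) := (1/n)·(C(x) − conj(B(x))ᵀ·A(x)⁻¹·B(x)) is Hermitian and positive definite. -/
/- STATEMENT 9: For x ∈ ℂ⁴ with all coordinates nonzero, the 2×2 matrix
H(x) = (1/n)·(C(x) − conj(B(x))ᵀ·A(x)⁻¹·B(x)) (the matrix of the natural metric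
of E(−2) in the frame (ã₁,ã₂)) is Hermitian and positive definite.
Here x 0,…,x 3 stand for x₁,…,x₄ and conj(B)ᵀ is the conjugate transpose Bᴴ. -/

open Matrix
open scoped ComplexOrder

noncomputable section

/-- n = 1 + Σ |x_i|², as a complex number. -/
def nC (x : Fin 4 → ℂ) : ℂ := 1 + ∑ i, star (x i) * x i

/-- The 5×5 matrix A(x). -/
def Amat (x : Fin 4 → ℂ) : Matrix (Fin 5) (Fin 5) ℂ :=
  !![nC x + 1, star (x 1) * x 3, star (x 3) * x 2, star (x 0) * x 1, star (x 2) * x 0;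
     star (x 3) * x 1, nC x + star (x 0) * x 0, star (x 2), x 3, star (x 1) * x 2;
     star (x 2) * x 3, x 2, nC x + star (x 1) * x 1, star (x 3) * x 0, star (x 0);
     star (x 1) * x 0, star (x 3), star (x 0) * x 3, nC x + star (x 2) * x 2, x 1;
     star (x 0) * x 2, star (x 2) * x 1, x 0, star (x 1), nC x + star (x 3) * x 3]

/-- The 5×2 matrix B(x). -/
def Bmat (x : Fin 4 → ℂ) : Matrix (Fin 5) (Fin 2) ℂ :=
  !![(star (x 0) * x 0 + star (x 3) * x 3) * star (x 1) * star (x 2),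
       -(star (x 1) * x 1 + star (x 2) * x 2) * star (x 0) * star (x 3);
     (1 + star (x 1) * x 1) * star (x 2) * star (x 3),
       -(star (x 2) * x 2 + star (x 3) * x 3) * star (x 1);
     (star (x 0) * x 0 + star (x 2) * x 2) * star (x 3),
       -(1 + star (x 3) * x 3) * star (x 0) * star (x 2);
     (star (x 1) * x 1 + star (x 3) * x 3) * star (x 0),
       -(1 + star (x 0) * x 0) * star (x 1) * star (x 3);
     (1 + star (x 2) * x 2) * star (x 0) * star (x 1),
       -(star (x 0) * x 0 + star (x 1) * x 1) * star (x 2)]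

/-- The 2×2 diagonal matrix C(x) = diag(c₁,c₂). -/
def Cmat (x : Fin 4 → ℂ) : Matrix (Fin 2) (Fin 2) ℂ :=
  !![star (x 0) * x 0 * (star (x 1) * x 1) * (1 + star (x 2) * x 2)
       + star (x 0) * x 0 * (star (x 3) * x 3)
       + star (x 2) * x 2 * (star (x 3) * x 3) * (1 + star (x 1) * x 1), 0;
     0, star (x 0) * x 0 * (star (x 2) * x 2) * (1 + star (x 3) * x 3)
       + star (x 1) * x 1 * (star (x 2) * x 2)
       + star (x 1) * x 1 * (star (x 3) * x 3) * (1 + star (x 0) * x 0)]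

/-- The matrix H(x) = (1/n)·(C − Bᴴ·A⁻¹·B) of the natural metric of E(−2). -/
def Hmat (x : Fin 4 → ℂ) : Matrix (Fin 2) (Fin 2) ℂ :=
  (1 / nC x) • (Cmat x - (Bmat x)ᴴ * (Amat x)⁻¹ * Bmat x)

/-- Koszul-type blocks whose Gram matrix gives A, B, C. -/
def hmD (x : Fin 4 → ℂ) : Matrix (Fin 5) (Fin 5) ℂ :=
  !![1, 0, 0, 0, 0;
     0, star (x 0), 0, 0, 0;
     0, 0, star (x 1), 0, 0;
     0, 0, 0, star (x 2), 0;
     0, 0, 0, 0, star (x 3)]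

def hmP (x : Fin 4 → ℂ) : Matrix (Fin 5) (Fin 5) ℂ :=
  !![0, 0, 0, star (x 1), 1;
     star (x 0), 0, 0, 0, star (x 2);
     star (x 3), star (x 1), 0, 0, 0;
     0, 1, star (x 2), 0, 0;
     0, 0, star (x 0), star (x 3), 0]

def hmN (x : Fin 4 → ℂ) : Matrix (Fin 5) (Fin 5) ℂ :=
  !![0, star (x 2), 0, 0, star (x 1);
     star (x 2), 0, star (x 3), 0, 0;
     0, star (x 3), 0, 1, 0;
     0, 0, 1, 0, star (x 0);
     star (x 1), 0, 0, star (x 0), 0]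

def hmQP (x : Fin 4 → ℂ) : Matrix (Fin 5) (Fin 2) ℂ :=
  !![1 * star (x 0) * star (x 1), 0;
     star (x 0) * star (x 1) * star (x 2), 0;
     star (x 1) * star (x 2) * star (x 3), 0;
     star (x 2) * star (x 3) * 1, 0;
     star (x 3) * 1 * star (x 0), 0]

def hmQN (x : Fin 4 → ℂ) : Matrix (Fin 5) (Fin 2) ℂ :=
  !![0, -(star (x 2) * 1 * star (x 1));
     0, -(star (x 3) * star (x 0) * star (x 2));
     0, -(1 * star (x 1) * star (x 3));
     0, -(star (x 0) * star (x 2) * 1);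
     0, -(star (x 1) * star (x 3) * star (x 0))]


theorem hm_A (x : Fin 4 → ℂ) : Amat x =
    (hmD x)ᴴ * hmD x + (hmD x)ᴴ * hmD x + ((hmP x)ᴴ * hmP x + (hmN x)ᴴ * hmN x) := by
  ext i j
  fin_cases i <;> fin_cases j <;>
    simp [Amat, hmD, hmP, hmN, nC, Matrix.mul_apply, Fin.sum_univ_succ] <;> ring

theorem hm_B (x : Fin 4 → ℂ) : Bmat x = (hmP x)ᴴ * hmQP x + (hmN x)ᴴ * hmQN x := by
  ext i j
  fin_cases i <;> fin_cases j <;>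
    simp [Bmat, hmP, hmN, hmQP, hmQN, Matrix.mul_apply, Fin.sum_univ_succ] <;> ring

theorem hm_C (x : Fin 4 → ℂ) : Cmat x = (hmQP x)ᴴ * hmQP x + (hmQN x)ᴴ * hmQN x := by
  ext i j
  fin_cases i <;> fin_cases j <;>
    simp [Cmat, hmQP, hmQN, Matrix.mul_apply, Fin.sum_univ_succ] <;> ring

/-- General Schur complement positivity for Gram matrices. -/
theorem gram_schur {m k l : Type*} [Fintype m] [Fintype k] [Fintype l] [DecidableEq k]
    (P : Matrix m k ℂ) (Q : Matrix m l ℂ)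
    (h : ∀ v u, P *ᵥ v + Q *ᵥ u = 0 → v = 0 ∧ u = 0) :
    (Qᴴ * Q - (Pᴴ * Q)ᴴ * (Pᴴ * P)⁻¹ * (Pᴴ * Q)).PosDef := by
  classical
  have hP : Function.Injective P.mulVec := by
    intro a b hab
    have h1 := (h (a - b) 0 (by simp [Matrix.mulVec_sub]; exact sub_eq_zero.2 hab)).1
    exact sub_eq_zero.1 h1
  have hA : (Pᴴ * P).PosDef := Matrix.PosDef.conjTranspose_mul_self P hP
  have hdet : IsUnit (Pᴴ * P).det := (Matrix.isUnit_iff_isUnit_det _).1 hA.isUnit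
  set R : Matrix m l ℂ := Q - P * ((Pᴴ * P)⁻¹ * (Pᴴ * Q)) with hR
  have h0 : Pᴴ * R = 0 := by
    rw [hR, Matrix.mul_sub, ← Matrix.mul_assoc, Matrix.mul_nonsing_inv_cancel_left _ _ hdet,
      sub_self]
  have h1 : Qᴴ * Q - (Pᴴ * Q)ᴴ * (Pᴴ * P)⁻¹ * (Pᴴ * Q) = Rᴴ * R := by
    have h2 : Rᴴ * R = Qᴴ * R := by
      conv_lhs => rw [hR, Matrix.conjTranspose_sub, Matrix.conjTranspose_mul P, ← hR,
        Matrix.sub_mul, Matrix.mul_assoc, h0, Matrix.mul_zero, sub_zero]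
    rw [h2, hR, Matrix.mul_sub, Matrix.conjTranspose_mul, Matrix.conjTranspose_conjTranspose]
    simp only [Matrix.mul_assoc]
  rw [h1]
  apply Matrix.PosDef.conjTranspose_mul_self
  intro a b hab
  have h3 : R *ᵥ (a - b) = 0 := by rw [Matrix.mulVec_sub]; exact sub_eq_zero.2 hab
  have h4 := (h (-(((Pᴴ * P)⁻¹ * (Pᴴ * Q)) *ᵥ (a - b))) (a - b) (by
    rw [← h3, hR, Matrix.sub_mulVec, Matrix.mulVec_neg, Matrix.mulVec_mulVec]; abel)).2
  exact sub_eq_zero.1 h4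

theorem horrocks_mumford_stmt9 (x : Fin 4 → ℂ) (hx : ∀ i, x i ≠ 0) :
    (Hmat x).IsHermitian ∧ (Hmat x).PosDef := by
  suffices hH : (Hmat x).PosDef from ⟨hH.1, hH⟩
  have key := gram_schur
    (Matrix.fromRows (Matrix.fromRows (hmD x) (hmD x)) (Matrix.fromRows (hmP x) (hmN x)))
    (Matrix.fromRows (Matrix.fromRows (0 : Matrix (Fin 5) (Fin 2) ℂ)
      (0 : Matrix (Fin 5) (Fin 2) ℂ)) (Matrix.fromRows (hmQP x) (hmQN x))) (by
    intro v u huv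
    simp only [Matrix.fromRows_mulVec] at huv
    have hv : v = 0 := by
      ext i
      have h1 := congrFun huv (Sum.inl (Sum.inl i))
      have h2 := hx 0
      have h3 := hx 1
      have h4 := hx 2
      have h5 := hx 3
      fin_cases i <;>
        simpa [hmD, Matrix.mulVec, dotProduct, Fin.sum_univ_succ, h2, h3, h4, h5] using h1
    subst hv
    refine ⟨rfl, ?_⟩
    ext i
    fin_cases i
    · have h1 := congrFun huv (Sum.inr (Sum.inl 0))
      simpa [hmQP, Matrix.mulVec, dotProduct, Fin.sum_univ_succ, hx] using h1
    · have h1 := congrFun huv (Sum.inr (Sum.inr 0))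
      simpa [hmQN, Matrix.mulVec, dotProduct, Fin.sum_univ_succ, hx] using h1)
  simp only [Matrix.conjTranspose_fromRows_eq_fromCols_conjTranspose,
    Matrix.fromCols_mul_fromRows, Matrix.conjTranspose_zero, Matrix.mul_zero, add_zero,
    zero_add] at key
  rw [← hm_A, ← hm_B, ← hm_C] at key
  have hn : 0 < 1 / nC x := by
    have : 0 < nC x := by
      unfold nC
      exact add_pos_of_pos_of_nonneg one_pos
        (Finset.sum_nonneg fun i _ => star_mul_self_nonneg (x i))
    exact one_div_pos.2 this
  exact key.smul hn
end
end

section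
/- Let x⁰ = (1,1,1,1) ∈ ℂ⁴. Then ν(x⁰, conj x⁰) ≠ 0, Â(x⁰, conj x⁰) and H(x⁰) := Ĥ(x⁰, conj x⁰) are invertible, all partial derivatives ∂_α Ĥ, ∂̄_β Ĥ, ∂_α∂̄_β Ĥ (1 ≤ α,β ≤ 4) exist at (x⁰, conj x⁰), and the mean-curvature matrix satisfies K(x⁰) = 2·I₂ (twice the 2×2 identity matrix). -/
open Matrix

noncomputable section

/-- ν(x,y) = 1 + Σ x_i y_i, the polarization of n(x) = 1 + Σ |x_i|². -/
def nu (x y : Fin 4 → ℂ) : ℂ := 1 + ∑ i, x i * y i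

/-- The pointwise conjugate vector, y = conj x. -/
def cconj (x : Fin 4 → ℂ) : Fin 4 → ℂ := fun i => star (x i)

/-- Â(x,y), the polarization of the 5×5 matrix A(x): every |x_i|² is replaced
by x_i·y_i and every conj(x_i) by y_i, so that Â(x, conj x) = A(x).
Here x 0,…,x 3 stand for x₁,…,x₄. -/
def Ahat (x y : Fin 4 → ℂ) : Matrix (Fin 5) (Fin 5) ℂ :=
  !![nu x y + 1, y 1 * x 3, y 3 * x 2, y 0 * x 1, y 2 * x 0;
     y 3 * x 1, nu x y + x 0 * y 0, y 2, x 3, y 1 * x 2;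
     y 2 * x 3, x 2, nu x y + x 1 * y 1, y 3 * x 0, y 0;
     y 1 * x 0, y 3, y 0 * x 3, nu x y + x 2 * y 2, x 1;
     y 0 * x 2, y 2 * x 1, x 0, y 1, nu x y + x 3 * y 3]

/-- B̂(x,y), the polarization of the 5×2 matrix B(x), with B̂(x, conj x) = B(x). -/
def Bhat (x y : Fin 4 → ℂ) : Matrix (Fin 5) (Fin 2) ℂ :=
  !![(x 0 * y 0 + x 3 * y 3) * y 1 * y 2, -(x 1 * y 1 + x 2 * y 2) * y 0 * y 3;
     (1 + x 1 * y 1) * y 2 * y 3, -(x 2 * y 2 + x 3 * y 3) * y 1;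
     (x 0 * y 0 + x 2 * y 2) * y 3, -(1 + x 3 * y 3) * y 0 * y 2;
     (x 1 * y 1 + x 3 * y 3) * y 0, -(1 + x 0 * y 0) * y 1 * y 3;
     (1 + x 2 * y 2) * y 0 * y 1, -(x 0 * y 0 + x 1 * y 1) * y 2]

/-- Ĉ(x,y) = diag(ĉ₁,ĉ₂), the polarization of C(x), with Ĉ(x, conj x) = C(x). -/
def Chat (x y : Fin 4 → ℂ) : Matrix (Fin 2) (Fin 2) ℂ :=
  !![x 0 * y 0 * (x 1 * y 1) * (1 + x 2 * y 2) + x 0 * y 0 * (x 3 * y 3)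
       + x 2 * y 2 * (x 3 * y 3) * (1 + x 1 * y 1), 0;
     0, x 0 * y 0 * (x 2 * y 2) * (1 + x 3 * y 3) + x 1 * y 1 * (x 2 * y 2)
       + x 1 * y 1 * (x 3 * y 3) * (1 + x 0 * y 0)]

/-- B̂*(x,y) := (B̂(y,x))ᵀ, so that B̂*(x, conj x) = conj(B(x))ᵀ. -/
def BhatStar (x y : Fin 4 → ℂ) : Matrix (Fin 2) (Fin 5) ℂ := (Bhat y x)ᵀ

/-- Ĥ(x,y) = ν(x,y)⁻¹ · (Ĉ(x,y) − B̂*(x,y)·Â(x,y)⁻¹·B̂(x,y)); Ĥ(x, conj x) is the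
matrix H(x) of the natural metric of E(−2) in the frame (ã₁,ã₂). -/
def Hhat (x y : Fin 4 → ℂ) : Matrix (Fin 2) (Fin 2) ℂ :=
  (nu x y)⁻¹ • (Chat x y - BhatStar x y * (Ahat x y)⁻¹ * Bhat x y)

/-- ∂_α Ĥ : the complex derivative of t ↦ Ĥ(x + t·e_α, y)_{ij} at t = 0. -/
def dH (α : Fin 4) (x y : Fin 4 → ℂ) (i j : Fin 2) : ℂ :=
  deriv (fun t : ℂ => Hhat (x + t • (Pi.single α 1 : Fin 4 → ℂ)) y i j) 0

/-- ∂̄_β Ĥ : the complex derivative of s ↦ Ĥ(x, y + s·e_β)_{ij} at s = 0. -/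
def dbH (β : Fin 4) (x y : Fin 4 → ℂ) (i j : Fin 2) : ℂ :=
  deriv (fun s : ℂ => Hhat x (y + s • (Pi.single β 1 : Fin 4 → ℂ)) i j) 0

/-- ∂_α ∂̄_β Ĥ : the mixed second derivative. -/
def ddH (α β : Fin 4) (x y : Fin 4 → ℂ) (i j : Fin 2) : ℂ :=
  deriv (fun s : ℂ => dH α x (y + s • (Pi.single β 1 : Fin 4 → ℂ)) i j) 0

/-- g^{βα}(x) = n(x)·(δ_{αβ} + conj(x_β)·x_α), the inverse Fubini–Study
coefficients in the standard affine chart. -/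
def gUp (x : Fin 4 → ℂ) (β α : Fin 4) : ℂ :=
  nu x (cconj x) * ((if α = β then 1 else 0) + star (x β) * x α)

/-- The mean-curvature matrix K(x) of the natural metric of E(−2) with respect
to the Fubini–Study metric:
K_{ij} = −Σ_{α,β} g^{βα}·( Σ_k ∂_α∂̄_β Ĥ_{ik}·(H⁻¹)_{kj}
                           − Σ_{k,l,m} ∂_α Ĥ_{ik}·(H⁻¹)_{kl}·∂̄_β Ĥ_{lm}·(H⁻¹)_{mj} ),
all derivatives evaluated at (x, conj x) and H = Ĥ(x, conj x). -/
def Kmat (x : Fin 4 → ℂ) : Matrix (Fin 2) (Fin 2) ℂ :=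
  Matrix.of fun i j =>
    -∑ α : Fin 4, ∑ β : Fin 4, gUp x β α *
      ((∑ k : Fin 2, ddH α β x (cconj x) i k * (Hhat x (cconj x))⁻¹ k j)
        - ∑ k : Fin 2, ∑ l : Fin 2, ∑ m : Fin 2,
            dH α x (cconj x) i k * (Hhat x (cconj x))⁻¹ k l *
              dbH β x (cconj x) l m * (Hhat x (cconj x))⁻¹ m j)

set_option linter.unusedSimpArgs false

/-! ### Entrywise derivatives of matrix-valued functions -/

def MD {m n : Type*} (F : ℂ → Matrix m n ℂ) (F' : Matrix m n ℂ) : Prop :=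
  ∀ i j, HasDerivAt (fun t => F t i j) (F' i j) 0

section MDlemmas
variable {l m n : Type*}

lemma MD.sub {F G : ℂ → Matrix m n ℂ} {F' G' : Matrix m n ℂ} (hF : MD F F') (hG : MD G G') :
    MD (fun t => F t - G t) (F' - G') := fun i j => (hF i j).sub (hG i j)

lemma MD.add {F G : ℂ → Matrix m n ℂ} {F' G' : Matrix m n ℂ} (hF : MD F F') (hG : MD G G') :
    MD (fun t => F t + G t) (F' + G') := fun i j => (hF i j).add (hG i j)

lemma MD.smul {c : ℂ → ℂ} {c' : ℂ} {F : ℂ → Matrix m n ℂ} {F' : Matrix m n ℂ}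
    (hc : HasDerivAt c c' 0) (hF : MD F F') :
    MD (fun t => c t • F t) (c' • F 0 + c 0 • F') := fun i j => hc.mul (hF i j)

lemma MD.affine (M M' : Matrix m n ℂ) : MD (fun t => M + t • M') M' := fun i j => by
  simpa using ((hasDerivAt_id (0 : ℂ)).mul_const (M' i j)).const_add (M i j)

lemma MD.mul [Fintype m] {F : ℂ → Matrix l m ℂ} {G : ℂ → Matrix m n ℂ} {F' : Matrix l m ℂ}
    {G' : Matrix m n ℂ} (hF : MD F F') (hG : MD G G') :
    MD (fun t => F t * G t) (F' * G 0 + F 0 * G') := fun i j => by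
  simp only [Matrix.mul_apply, Matrix.add_apply, ← Finset.sum_add_distrib]
  exact HasDerivAt.fun_sum fun k _ => (hF i k).mul (hG k j)

lemma diff_det [Fintype n] [DecidableEq n] {F : ℂ → Matrix n n ℂ}
    (hF : ∀ i j, DifferentiableAt ℂ (fun t => F t i j) 0) :
    DifferentiableAt ℂ (fun t => (F t).det) 0 := by
  simp only [Matrix.det_apply]
  refine DifferentiableAt.fun_sum fun σ _ => ?_
  refine DifferentiableAt.const_smul ?_ _
  exact DifferentiableAt.fun_finsetProd fun i _ => hF _ _

lemma MD.inv [Fintype n] [DecidableEq n] {F : ℂ → Matrix n n ℂ} {F' : Matrix n n ℂ}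
    (hF : MD F F') (h0 : (F 0).det ≠ 0) :
    MD (fun t => (F t)⁻¹) (-((F 0)⁻¹ * F' * (F 0)⁻¹)) := by
  have hd : DifferentiableAt ℂ (fun t => (F t).det) 0 :=
    diff_det fun i j => (hF i j).differentiableAt
  have hi : ∀ i j, DifferentiableAt ℂ (fun t => (F t)⁻¹ i j) 0 := by
    intro i j
    simp only [Matrix.inv_def, Ring.inverse_eq_inv', Matrix.smul_apply, smul_eq_mul,
      Matrix.adjugate_apply]
    refine (hd.inv h0).mul (diff_det fun a b => ?_)
    by_cases h : a = j
    · subst h; simp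
    · simpa [Matrix.updateRow_apply, h] using (hF a b).differentiableAt
  have hN : MD (fun t => (F t)⁻¹) (Matrix.of fun i j => deriv (fun t => (F t)⁻¹ i j) 0) :=
    fun i j => (hi i j).hasDerivAt
  have hu : IsUnit (F 0).det := isUnit_iff_ne_zero.mpr h0
  have hev : ∀ᶠ t in nhds (0 : ℂ), (F t).det ≠ 0 := hd.continuousAt.eventually_ne h0
  have key := hN.mul hF
  generalize Matrix.of (fun i j => deriv (fun t => (F t)⁻¹ i j) 0) = N' at hN key
  have hz : N' * F 0 + (F 0)⁻¹ * F' = 0 := by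
    ext i j
    refine (key i j).unique ?_
    refine (hasDerivAt_const (0 : ℂ) ((1 : Matrix n n ℂ) i j)).congr_of_eventuallyEq ?_
    filter_upwards [hev] with t ht
    rw [Matrix.nonsing_inv_mul _ (isUnit_iff_ne_zero.mpr ht)]
  have : N' = -((F 0)⁻¹ * F' * (F 0)⁻¹) := by
    have h2 : N' * F 0 = -((F 0)⁻¹ * F') := eq_neg_of_add_eq_zero_left hz
    calc N' = N' * F 0 * (F 0)⁻¹ := by rw [Matrix.mul_assoc, Matrix.mul_nonsing_inv _ hu, Matrix.mul_one]
      _ = _ := by rw [h2, Matrix.neg_mul]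
  exact this ▸ hN

end MDlemmas

/-! ### Derivative formulas for a Schur complement -/

section formulas
variable {R : Type*} [Field R]

/-- Value of the Schur complement. -/
def sch0 (N : Matrix (Fin 5) (Fin 5) R) (B : Matrix (Fin 5) (Fin 2) R)
    (C : Matrix (Fin 2) (Fin 2) R) (D : Matrix (Fin 2) (Fin 5) R) : Matrix (Fin 2) (Fin 2) R :=
  C - D * N * B

/-- First derivative of the Schur complement. -/
def sch1 (N Ad : Matrix (Fin 5) (Fin 5) R) (B Bd : Matrix (Fin 5) (Fin 2) R)
    (Cd : Matrix (Fin 2) (Fin 2) R) (D Dd : Matrix (Fin 2) (Fin 5) R) :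
    Matrix (Fin 2) (Fin 2) R :=
  Cd - Dd * (N * B) + (D * N) * Ad * (N * B) - (D * N) * Bd

/-- Mixed second derivative of the Schur complement. -/
def sch2 (N A1 A2 A3 : Matrix (Fin 5) (Fin 5) R) (B B1 B2 B3 : Matrix (Fin 5) (Fin 2) R)
    (C3 : Matrix (Fin 2) (Fin 2) R) (D D1 D2 D3 : Matrix (Fin 2) (Fin 5) R) :
    Matrix (Fin 2) (Fin 2) R :=
  C3 - D3 * (N * B) + (D * N) * A3 * (N * B) - (D * N) * B3
    - (D1 - D * N * A1) * N * (B2 - A2 * (N * B)) - (D2 - D * N * A2) * N * (B1 - A1 * (N * B))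

/-- First derivative of `ν⁻¹ • Q`. -/
def quo1 (n n1 : R) (Q Q1 : Matrix (Fin 2) (Fin 2) R) : Matrix (Fin 2) (Fin 2) R :=
  (-n1 / n ^ 2) • Q + n⁻¹ • Q1

/-- Mixed second derivative of `ν⁻¹ • Q`. -/
def quo2 (n n1 n2 n3 : R) (Q Q1 Q2 Q3 : Matrix (Fin 2) (Fin 2) R) : Matrix (Fin 2) (Fin 2) R :=
  (2 * n1 * n2 / n ^ 3 - n3 / n ^ 2) • Q + (-n1 / n ^ 2) • Q2 + (-n2 / n ^ 2) • Q1 + n⁻¹ • Q3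

end formulas

lemma MD.sch1 {A : ℂ → Matrix (Fin 5) (Fin 5) ℂ} {B : ℂ → Matrix (Fin 5) (Fin 2) ℂ}
    {C : ℂ → Matrix (Fin 2) (Fin 2) ℂ} {D : ℂ → Matrix (Fin 2) (Fin 5) ℂ} {A' B' C' D'}
    (hA : MD A A') (hB : MD B B') (hC : MD C C') (hD : MD D D') (h0 : (A 0).det ≠ 0) :
    MD (fun t => sch0 (A t)⁻¹ (B t) (C t) (D t)) (sch1 (A 0)⁻¹ A' (B 0) B' C' (D 0) D') := by
  convert hC.sub ((hD.mul (hA.inv h0)).mul hB) using 1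
  · rfl
  unfold _root_.sch1
  simp only [Matrix.mul_add, Matrix.add_mul, Matrix.mul_sub, Matrix.sub_mul, Matrix.mul_neg,
    Matrix.neg_mul, Matrix.mul_assoc]
  abel

lemma MD.sch2 {A A1 : ℂ → Matrix (Fin 5) (Fin 5) ℂ} {B B1 : ℂ → Matrix (Fin 5) (Fin 2) ℂ}
    {C1 : ℂ → Matrix (Fin 2) (Fin 2) ℂ} {D D1 : ℂ → Matrix (Fin 2) (Fin 5) ℂ}
    {A2 A3 B2 B3 C3 D2 D3}
    (hA : MD A A2) (hB : MD B B2) (hD : MD D D2)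
    (hA1 : MD A1 A3) (hB1 : MD B1 B3) (hC1 : MD C1 C3) (hD1 : MD D1 D3) (h0 : (A 0).det ≠ 0) :
    MD (fun t => _root_.sch1 (A t)⁻¹ (A1 t) (B t) (B1 t) (C1 t) (D t) (D1 t))
      (_root_.sch2 (A 0)⁻¹ (A1 0) A2 A3 (B 0) (B1 0) B2 B3 C3 (D 0) (D1 0) D2 D3) := by
  have hN := hA.inv h0
  convert ((hC1.sub (hD1.mul (hN.mul hB))).add (((hD.mul hN).mul hA1).mul (hN.mul hB))).sub
    ((hD.mul hN).mul hB1) using 1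
  · rfl
  unfold _root_.sch2
  simp only [Matrix.mul_add, Matrix.add_mul, Matrix.mul_sub, Matrix.sub_mul, Matrix.mul_neg,
    Matrix.neg_mul, Matrix.mul_assoc]
  abel

lemma MD.quo1 {n : ℂ → ℂ} {n'} {Q : ℂ → Matrix (Fin 2) (Fin 2) ℂ} {Q'}
    (hn : HasDerivAt n n' 0) (hQ : MD Q Q') (h0 : n 0 ≠ 0) :
    MD (fun t => (n t)⁻¹ • Q t) (quo1 (n 0) n' (Q 0) Q') :=
  MD.smul (hn.fun_inv h0) hQ

lemma MD.quo2 {n n1 : ℂ → ℂ} {n2 n3} {Q Q1 : ℂ → Matrix (Fin 2) (Fin 2) ℂ} {Q2 Q3}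
    (hn : HasDerivAt n n2 0) (hn1 : HasDerivAt n1 n3 0) (hQ : MD Q Q2) (hQ1 : MD Q1 Q3)
    (h0 : n 0 ≠ 0) :
    MD (fun t => _root_.quo1 (n t) (n1 t) (Q t) (Q1 t))
      (_root_.quo2 (n 0) (n1 0) n2 n3 (Q 0) (Q1 0) Q2 Q3) := by
  convert (MD.smul (hn1.fun_neg.fun_div (hn.fun_pow 2) (pow_ne_zero 2 h0)) hQ).add
    (MD.smul (hn.fun_inv h0) hQ1) using 1
  · rfl
  unfold _root_.quo2
  have e : 2 * n1 0 * n2 / n 0 ^ 3 - n3 / n 0 ^ 2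
      = (-n3 * n 0 ^ 2 - -n1 0 * (((2 : ℕ) : ℂ) * n 0 ^ (2 - 1) * n2)) / (n 0 ^ 2) ^ 2 := by
    push_cast
    field_simp
    ring
  rw [e, ← add_assoc]

/-! ### Polymorphic copies of the data -/

section poly
variable {R : Type*} [CommRing R]

def gnu (x y : Fin 4 → R) : R := 1 + ∑ i, x i * y i

def gA (x y : Fin 4 → R) : Matrix (Fin 5) (Fin 5) R :=
  !![gnu x y + 1, y 1 * x 3, y 3 * x 2, y 0 * x 1, y 2 * x 0;
     y 3 * x 1, gnu x y + x 0 * y 0, y 2, x 3, y 1 * x 2;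
     y 2 * x 3, x 2, gnu x y + x 1 * y 1, y 3 * x 0, y 0;
     y 1 * x 0, y 3, y 0 * x 3, gnu x y + x 2 * y 2, x 1;
     y 0 * x 2, y 2 * x 1, x 0, y 1, gnu x y + x 3 * y 3]

def gB (x y : Fin 4 → R) : Matrix (Fin 5) (Fin 2) R :=
  !![(x 0 * y 0 + x 3 * y 3) * y 1 * y 2, -(x 1 * y 1 + x 2 * y 2) * y 0 * y 3;
     (1 + x 1 * y 1) * y 2 * y 3, -(x 2 * y 2 + x 3 * y 3) * y 1;
     (x 0 * y 0 + x 2 * y 2) * y 3, -(1 + x 3 * y 3) * y 0 * y 2;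
     (x 1 * y 1 + x 3 * y 3) * y 0, -(1 + x 0 * y 0) * y 1 * y 3;
     (1 + x 2 * y 2) * y 0 * y 1, -(x 0 * y 0 + x 1 * y 1) * y 2]

def gC (x y : Fin 4 → R) : Matrix (Fin 2) (Fin 2) R :=
  !![x 0 * y 0 * (x 1 * y 1) * (1 + x 2 * y 2) + x 0 * y 0 * (x 3 * y 3)
       + x 2 * y 2 * (x 3 * y 3) * (1 + x 1 * y 1), 0;
     0, x 0 * y 0 * (x 2 * y 2) * (1 + x 3 * y 3) + x 1 * y 1 * (x 2 * y 2)
       + x 1 * y 1 * (x 3 * y 3) * (1 + x 0 * y 0)]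

def gD (x y : Fin 4 → R) : Matrix (Fin 2) (Fin 5) R := (gB y x)ᵀ

/-- unit vector -/
def ue (α : Fin 4) : Fin 4 → R := Pi.single α 1

/-- finite difference in `x` (equal to the partial derivative for multi-affine functions) -/
def fdx {V : Type*} [AddCommGroup V] (f : (Fin 4 → R) → (Fin 4 → R) → V) (α : Fin 4)
    (x y : Fin 4 → R) : V := f (x + ue α) y - f x y

def fdy {V : Type*} [AddCommGroup V] (f : (Fin 4 → R) → (Fin 4 → R) → V) (β : Fin 4)
    (x y : Fin 4 → R) : V := f x (y + ue β) - f x y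

/-- affine in each single coordinate of `x` and of `y` -/
def MA {V : Type*} [AddCommGroup V] [Module R V] (f : (Fin 4 → R) → (Fin 4 → R) → V) : Prop :=
  (∀ α x y (t : R), f (x + t • ue α) y = f x y + t • fdx f α x y) ∧
  (∀ β x y (t : R), f x (y + t • ue β) = f x y + t • fdy f β x y)

lemma MA.fdx_shift {V : Type*} [AddCommGroup V] [Module R V]
    {f : (Fin 4 → R) → (Fin 4 → R) → V} (h : MA f) (α β x y) (t : R) :
    fdx f α x (y + t • ue β) = fdx f α x y + t • fdy (fdx f α) β x y := by
  simp only [fdx, h.2 β, fdy, smul_sub]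
  abel

lemma gnu_MA : MA (gnu : (Fin 4 → R) → (Fin 4 → R) → R) := by
  constructor <;> intro α x y t <;> fin_cases α <;>
    simp [gnu, fdx, fdy, ue, Fin.sum_univ_four, Pi.single_apply] <;> ring

set_option maxHeartbeats 4000000 in
lemma gA_MA : MA (gA : (Fin 4 → R) → (Fin 4 → R) → _) := by
  constructor <;> intro α x y t <;> fin_cases α <;> ext i j <;> fin_cases i <;> fin_cases j <;>
    simp [gA, gnu, fdx, fdy, ue, Fin.sum_univ_four, Pi.single_apply] <;> ring

set_option maxHeartbeats 4000000 in
lemma gB_MA : MA (gB : (Fin 4 → R) → (Fin 4 → R) → _) := by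
  constructor <;> intro α x y t <;> fin_cases α <;> ext i j <;> fin_cases i <;> fin_cases j <;>
    simp [gB, fdx, fdy, ue, Pi.single_apply] <;> ring

set_option maxHeartbeats 4000000 in
lemma gC_MA : MA (gC : (Fin 4 → R) → (Fin 4 → R) → _) := by
  constructor <;> intro α x y t <;> fin_cases α <;> ext i j <;> fin_cases i <;> fin_cases j <;>
    simp [gC, fdx, fdy, ue, Pi.single_apply] <;> ring

lemma gD_MA : MA (gD : (Fin 4 → R) → (Fin 4 → R) → _) := by
  constructor
  · intro α x y t
    simp only [gD, fdx, gB_MA.2 α, fdy, Matrix.transpose_add, Matrix.transpose_smul,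
      Matrix.transpose_sub]
  · intro α x y t
    simp only [gD, fdy, gB_MA.1 α, fdx, Matrix.transpose_add, Matrix.transpose_smul,
      Matrix.transpose_sub]

end poly

lemma Hhat_eq (x y : Fin 4 → ℂ) :
    Hhat x y = (gnu x y)⁻¹ • sch0 (gA x y)⁻¹ (gB x y) (gC x y) (gD x y) := rfl

lemma MA.MDx {m n : Type*} {f : (Fin 4 → ℂ) → (Fin 4 → ℂ) → Matrix m n ℂ} (h : MA f) (α x y) :
    MD (fun t => f (x + t • ue α) y) (fdx f α x y) := by
  simp only [h.1 α]
  exact MD.affine _ _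

lemma MA.MDy {m n : Type*} {f : (Fin 4 → ℂ) → (Fin 4 → ℂ) → Matrix m n ℂ} (h : MA f) (α x y) :
    MD (fun t => f x (y + t • ue α)) (fdy f α x y) := by
  simp only [h.2 α]
  exact MD.affine _ _

lemma MA.MDxy {m n : Type*} {f : (Fin 4 → ℂ) → (Fin 4 → ℂ) → Matrix m n ℂ} (h : MA f) (α β x y) :
    MD (fun t => fdx f α x (y + t • ue β)) (fdy (fdx f α) β x y) := by
  simp only [h.fdx_shift]
  exact MD.affine _ _

lemma hasDerivAt_affine (a b : ℂ) : HasDerivAt (fun t : ℂ => a + t • b) b 0 := by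
  simpa using ((hasDerivAt_id (0 : ℂ)).mul_const b).const_add a

section values
variable {R : Type*} [Field R]

/-- formula for `∂_α Ĥ`, with `N = Â⁻¹`. -/
def vx (N : Matrix (Fin 5) (Fin 5) R) (α : Fin 4) (x y : Fin 4 → R) : Matrix (Fin 2) (Fin 2) R :=
  quo1 (gnu x y) (fdx gnu α x y) (sch0 N (gB x y) (gC x y) (gD x y))
    (sch1 N (fdx gA α x y) (gB x y) (fdx gB α x y) (fdx gC α x y) (gD x y) (fdx gD α x y))

def vy (N : Matrix (Fin 5) (Fin 5) R) (α : Fin 4) (x y : Fin 4 → R) : Matrix (Fin 2) (Fin 2) R :=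
  quo1 (gnu x y) (fdy gnu α x y) (sch0 N (gB x y) (gC x y) (gD x y))
    (sch1 N (fdy gA α x y) (gB x y) (fdy gB α x y) (fdy gC α x y) (gD x y) (fdy gD α x y))

def vxy (N : Matrix (Fin 5) (Fin 5) R) (α β : Fin 4) (x y : Fin 4 → R) :
    Matrix (Fin 2) (Fin 2) R :=
  quo2 (gnu x y) (fdx gnu α x y) (fdy gnu β x y) (fdy (fdx gnu α) β x y)
    (sch0 N (gB x y) (gC x y) (gD x y))
    (sch1 N (fdx gA α x y) (gB x y) (fdx gB α x y) (fdx gC α x y) (gD x y) (fdx gD α x y))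
    (sch1 N (fdy gA β x y) (gB x y) (fdy gB β x y) (fdy gC β x y) (gD x y) (fdy gD β x y))
    (sch2 N (fdx gA α x y) (fdy gA β x y) (fdy (fdx gA α) β x y)
      (gB x y) (fdx gB α x y) (fdy gB β x y) (fdy (fdx gB α) β x y)
      (fdy (fdx gC α) β x y)
      (gD x y) (fdx gD α x y) (fdy gD β x y) (fdy (fdx gD α) β x y))

end values

lemma MD_x (α : Fin 4) (x y : Fin 4 → ℂ) (hn : gnu x y ≠ 0) (hA : (gA x y).det ≠ 0) :
    MD (fun t => Hhat (x + t • ue α) y) (vx (gA x y)⁻¹ α x y) := by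
  have h1 : HasDerivAt (fun t : ℂ => gnu (x + t • ue α) y) (fdx gnu α x y) 0 := by
    simp only [gnu_MA.1 α]; exact hasDerivAt_affine _ _
  have := MD.quo1 h1 (MD.sch1 (gA_MA.MDx α x y) (gB_MA.MDx α x y) (gC_MA.MDx α x y)
    (gD_MA.MDx α x y) (by simpa using hA)) (by simpa using hn)
  simp only [zero_smul, add_zero] at this
  exact this

lemma MD_y (α : Fin 4) (x y : Fin 4 → ℂ) (hn : gnu x y ≠ 0) (hA : (gA x y).det ≠ 0) :
    MD (fun t => Hhat x (y + t • ue α)) (vy (gA x y)⁻¹ α x y) := by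
  have h1 : HasDerivAt (fun t : ℂ => gnu x (y + t • ue α)) (fdy gnu α x y) 0 := by
    simp only [gnu_MA.2 α]; exact hasDerivAt_affine _ _
  have := MD.quo1 h1 (MD.sch1 (gA_MA.MDy α x y) (gB_MA.MDy α x y) (gC_MA.MDy α x y)
    (gD_MA.MDy α x y) (by simpa using hA)) (by simpa using hn)
  simp only [zero_smul, add_zero] at this
  exact this

lemma MD_xy (α β : Fin 4) (x y : Fin 4 → ℂ) (hn : gnu x y ≠ 0) (hA : (gA x y).det ≠ 0) :
    MD (fun s => Matrix.of (dH α x (y + s • ue β))) (vxy (gA x y)⁻¹ α β x y) := by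
  have h1 : HasDerivAt (fun t : ℂ => gnu x (y + t • ue β)) (fdy gnu β x y) 0 := by
    simp only [gnu_MA.2 β]; exact hasDerivAt_affine _ _
  have h2 : HasDerivAt (fun t : ℂ => fdx gnu α x (y + t • ue β)) (fdy (fdx gnu α) β x y) 0 := by
    simp only [gnu_MA.fdx_shift]; exact hasDerivAt_affine _ _
  have hA0 : (gA x (y + (0 : ℂ) • ue β)).det ≠ 0 := by simpa using hA
  have hn0 : gnu x (y + (0 : ℂ) • ue β) ≠ 0 := by simpa using hn
  have key := MD.quo2 h1 h2
    (MD.sch1 (gA_MA.MDy β x y) (gB_MA.MDy β x y) (gC_MA.MDy β x y) (gD_MA.MDy β x y) hA0)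
    (MD.sch2 (gA_MA.MDy β x y) (gB_MA.MDy β x y) (gD_MA.MDy β x y)
      (gA_MA.MDxy α β x y) (gB_MA.MDxy α β x y) (gC_MA.MDxy α β x y) (gD_MA.MDxy α β x y) hA0)
    hn0
  simp only [zero_smul, add_zero] at key
  have hd : DifferentiableAt ℂ (fun t : ℂ => (gA x (y + t • ue β)).det) 0 :=
    diff_det fun i j => (gA_MA.MDy β x y i j).differentiableAt
  intro i j
  refine (key i j).congr_of_eventuallyEq ?_
  filter_upwards [hd.continuousAt.eventually_ne hA0, h1.continuousAt.eventually_ne hn0]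
    with s hs hs'
  exact (MD_x α x _ hs' hs i j).deriv

/-! ### Transfer to the rationals -/

section cast

lemma gnu_cast (x y : Fin 4 → ℚ) : gnu ((algebraMap ℚ ℂ) ∘ x) ((algebraMap ℚ ℂ) ∘ y) = (algebraMap ℚ ℂ) (gnu x y) := by
  simp [gnu]

lemma gA_cast (x y : Fin 4 → ℚ) : gA ((algebraMap ℚ ℂ) ∘ x) ((algebraMap ℚ ℂ) ∘ y) = (gA x y).map (algebraMap ℚ ℂ) := by
  ext i j; fin_cases i <;> fin_cases j <;> simp [gA, gnu]

lemma gB_cast (x y : Fin 4 → ℚ) : gB ((algebraMap ℚ ℂ) ∘ x) ((algebraMap ℚ ℂ) ∘ y) = (gB x y).map (algebraMap ℚ ℂ) := by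
  ext i j; fin_cases i <;> fin_cases j <;> simp [gB]

lemma gC_cast (x y : Fin 4 → ℚ) : gC ((algebraMap ℚ ℂ) ∘ x) ((algebraMap ℚ ℂ) ∘ y) = (gC x y).map (algebraMap ℚ ℂ) := by
  ext i j; fin_cases i <;> fin_cases j <;> simp [gC]

lemma gD_cast (x y : Fin 4 → ℚ) : gD ((algebraMap ℚ ℂ) ∘ x) ((algebraMap ℚ ℂ) ∘ y) = (gD x y).map (algebraMap ℚ ℂ) := by
  simp only [gD, gB_cast]; rfl

lemma ue_cast (x : Fin 4 → ℚ) (α : Fin 4) : (algebraMap ℚ ℂ) ∘ x + ue α = (algebraMap ℚ ℂ) ∘ (x + ue α) := by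
  ext i; by_cases h : i = α <;> simp [ue, Pi.single_apply, h]

lemma map_smul_cast {m n : Type*} (c : ℚ) (M : Matrix m n ℚ) :
    (c • M).map (algebraMap ℚ ℂ) = (algebraMap ℚ ℂ) c • M.map (algebraMap ℚ ℂ) := by
  ext; simp

lemma map_sub_cast {m n : Type*} (M N : Matrix m n ℚ) :
    (M - N).map (algebraMap ℚ ℂ) = M.map (algebraMap ℚ ℂ) - N.map (algebraMap ℚ ℂ) := by
  ext; simp

lemma map_add_cast {m n : Type*} (M N : Matrix m n ℚ) :
    (M + N).map (algebraMap ℚ ℂ) = M.map (algebraMap ℚ ℂ) + N.map (algebraMap ℚ ℂ) := by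
  ext; simp

lemma vx_cast (N : Matrix (Fin 5) (Fin 5) ℚ) (α) (x y : Fin 4 → ℚ) :
    vx (N.map (algebraMap ℚ ℂ)) α ((algebraMap ℚ ℂ) ∘ x) ((algebraMap ℚ ℂ) ∘ y) = (vx N α x y).map (algebraMap ℚ ℂ) := by
  simp only [vx, quo1, sch0, sch1, fdx, ue_cast, gnu_cast, gA_cast, gB_cast, gC_cast, gD_cast,
    map_smul_cast, map_sub_cast, map_add_cast, Matrix.map_mul, map_sub, map_neg, map_div₀, map_inv₀,
    map_pow]

lemma vy_cast (N : Matrix (Fin 5) (Fin 5) ℚ) (α) (x y : Fin 4 → ℚ) :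
    vy (N.map (algebraMap ℚ ℂ)) α ((algebraMap ℚ ℂ) ∘ x) ((algebraMap ℚ ℂ) ∘ y) = (vy N α x y).map (algebraMap ℚ ℂ) := by
  simp only [vy, quo1, sch0, sch1, fdy, ue_cast, gnu_cast, gA_cast, gB_cast, gC_cast, gD_cast,
    map_smul_cast, map_sub_cast, map_add_cast, Matrix.map_mul, map_sub, map_neg, map_div₀, map_inv₀,
    map_pow]

lemma vxy_cast (N : Matrix (Fin 5) (Fin 5) ℚ) (α β) (x y : Fin 4 → ℚ) :
    vxy (N.map (algebraMap ℚ ℂ)) α β ((algebraMap ℚ ℂ) ∘ x) ((algebraMap ℚ ℂ) ∘ y) = (vxy N α β x y).map (algebraMap ℚ ℂ) := by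
  simp only [vxy, quo2, sch0, sch1, sch2, fdx, fdy, ue_cast, gnu_cast, gA_cast, gB_cast, gC_cast,
    gD_cast, map_smul_cast, map_sub_cast, map_add_cast, Matrix.map_mul, map_sub, map_neg, map_div₀,
    map_inv₀, map_pow, map_mul, map_ofNat]

end cast

/-! ### Rational evaluation at the point -/

def xq : Fin 4 → ℚ := fun _ => 1

def Nq : Matrix (Fin 5) (Fin 5) ℚ := Matrix.of fun i j => if i = j then 9 / 50 else -1 / 50

def Iq : Matrix (Fin 2) (Fin 2) ℚ := !![3, -2; -2, 3]

def Hq : Matrix (Fin 2) (Fin 2) ℚ := !![3/5, 2/5; 2/5, 3/5]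

def Kq : Matrix (Fin 2) (Fin 2) ℚ :=
  Matrix.of fun i j =>
    -∑ α : Fin 4, ∑ β : Fin 4, (5 * ((if α = β then 1 else 0) + 1)) *
      ((∑ k : Fin 2, vxy Nq α β xq xq i k * Iq k j)
        - ∑ k : Fin 2, ∑ l : Fin 2, ∑ m : Fin 2,
            vx Nq α xq xq i k * Iq k l * vy Nq β xq xq l m * Iq m j)

lemma gA_Nq : gA xq xq * Nq = 1 := by decide +kernel
lemma Hq_eq : (gnu xq xq)⁻¹ • sch0 Nq (gB xq xq) (gC xq xq) (gD xq xq) = Hq := by decide +kernel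
lemma Hq_Iq : Hq * Iq = 1 := by decide +kernel
lemma Kq_eq : Kq = !![2, 0; 0, 2] := by decide +kernel

lemma x0_eq : (![1, 1, 1, 1] : Fin 4 → ℂ) = algebraMap ℚ ℂ ∘ xq := by
  ext i; fin_cases i <;> simp [xq]

lemma cconj_x0 : cconj (algebraMap ℚ ℂ ∘ xq) = algebraMap ℚ ℂ ∘ xq := by
  ext i; simp [xq, cconj]

lemma gnu_x0 : gnu (algebraMap ℚ ℂ ∘ xq) (algebraMap ℚ ℂ ∘ xq) = 5 := by
  simp [gnu, xq]; norm_num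

lemma gA_mul_x0 :
    gA (algebraMap ℚ ℂ ∘ xq) (algebraMap ℚ ℂ ∘ xq) * Nq.map (algebraMap ℚ ℂ) = 1 := by
  rw [gA_cast, ← Matrix.map_mul, gA_Nq]; simp

lemma gA_inv_x0 :
    (gA (algebraMap ℚ ℂ ∘ xq) (algebraMap ℚ ℂ ∘ xq))⁻¹ = Nq.map (algebraMap ℚ ℂ) :=
  Matrix.inv_eq_right_inv gA_mul_x0

lemma gA_det_x0 : (gA (algebraMap ℚ ℂ ∘ xq) (algebraMap ℚ ℂ ∘ xq)).det ≠ 0 :=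
  isUnit_iff_ne_zero.mp (Matrix.isUnit_det_of_right_inverse gA_mul_x0)

lemma Hhat_x0 :
    Hhat (algebraMap ℚ ℂ ∘ xq) (algebraMap ℚ ℂ ∘ xq) = Hq.map (algebraMap ℚ ℂ) := by
  rw [Hhat_eq, gA_inv_x0, ← Hq_eq]
  simp only [sch0, gnu_cast, gB_cast, gC_cast, gD_cast, map_smul_cast, map_sub_cast,
    Matrix.map_mul, map_inv₀]

lemma Hhat_mul_x0 :
    Hhat (algebraMap ℚ ℂ ∘ xq) (algebraMap ℚ ℂ ∘ xq) * Iq.map (algebraMap ℚ ℂ) = 1 := by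
  rw [Hhat_x0, ← Matrix.map_mul, Hq_Iq]; simp

lemma Hhat_inv_x0 :
    (Hhat (algebraMap ℚ ℂ ∘ xq) (algebraMap ℚ ℂ ∘ xq))⁻¹ = Iq.map (algebraMap ℚ ℂ) :=
  Matrix.inv_eq_right_inv Hhat_mul_x0

lemma gnu_ne_x0 : gnu (algebraMap ℚ ℂ ∘ xq) (algebraMap ℚ ℂ ∘ xq) ≠ 0 := by
  rw [gnu_x0]; norm_num

lemma dH_x0 (α i j) : dH α (algebraMap ℚ ℂ ∘ xq) (algebraMap ℚ ℂ ∘ xq) i j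
    = algebraMap ℚ ℂ (vx Nq α xq xq i j) := by
  have h := (MD_x α _ _ gnu_ne_x0 gA_det_x0 i j).deriv
  rw [gA_inv_x0, vx_cast] at h
  exact h

lemma dbH_x0 (α i j) : dbH α (algebraMap ℚ ℂ ∘ xq) (algebraMap ℚ ℂ ∘ xq) i j
    = algebraMap ℚ ℂ (vy Nq α xq xq i j) := by
  have h := (MD_y α _ _ gnu_ne_x0 gA_det_x0 i j).deriv
  rw [gA_inv_x0, vy_cast] at h
  exact h

lemma ddH_x0 (α β i j) : ddH α β (algebraMap ℚ ℂ ∘ xq) (algebraMap ℚ ℂ ∘ xq) i j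
    = algebraMap ℚ ℂ (vxy Nq α β xq xq i j) := by
  have h := (MD_xy α β _ _ gnu_ne_x0 gA_det_x0 i j).deriv
  rw [gA_inv_x0, vxy_cast] at h
  exact h

lemma gUp_x0 (α β) : gUp (algebraMap ℚ ℂ ∘ xq) β α
    = algebraMap ℚ ℂ (5 * ((if α = β then 1 else 0) + 1)) := by
  have : nu (algebraMap ℚ ℂ ∘ xq) (algebraMap ℚ ℂ ∘ xq) = 5 := gnu_x0
  rw [gUp, cconj_x0, this]
  by_cases h : α = β <;> simp [h, xq]

lemma Kmat_x0 : Kmat (algebraMap ℚ ℂ ∘ xq) = Kq.map (algebraMap ℚ ℂ) := by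
  ext i j
  simp only [Kmat, Kq, Matrix.of_apply, Matrix.map_apply, cconj_x0, dH_x0, dbH_x0, ddH_x0,
    Hhat_inv_x0, gUp_x0, map_neg, map_sum, map_mul, map_sub]

/-- at x⁰ = (1,1,1,1), ν ≠ 0, Â and H = Ĥ(x⁰, conj x⁰) are
invertible, all the partial derivatives of Ĥ involved exist at (x⁰, conj x⁰),
and the mean curvature satisfies K(x⁰) = 2·I₂. -/
theorem horrocks_mumford_stmt11 :
    let x0 : Fin 4 → ℂ := ![1, 1, 1, 1]
    nu x0 (cconj x0) ≠ 0 ∧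
    IsUnit (Ahat x0 (cconj x0)) ∧
    IsUnit (Hhat x0 (cconj x0)) ∧
    (∀ (α : Fin 4) (i j : Fin 2),
      DifferentiableAt ℂ (fun t : ℂ => Hhat (x0 + t • (Pi.single α 1 : Fin 4 → ℂ)) (cconj x0) i j) 0) ∧
    (∀ (β : Fin 4) (i j : Fin 2),
      DifferentiableAt ℂ (fun s : ℂ => Hhat x0 (cconj x0 + s • (Pi.single β 1 : Fin 4 → ℂ)) i j) 0) ∧
    (∀ (α β : Fin 4) (i j : Fin 2),
      DifferentiableAt ℂ (fun s : ℂ => dH α x0 (cconj x0 + s • (Pi.single β 1 : Fin 4 → ℂ)) i j) 0) ∧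
    Kmat x0 = (2 : ℂ) • (1 : Matrix (Fin 2) (Fin 2) ℂ) := by
  intro x0
  have hx : x0 = algebraMap ℚ ℂ ∘ xq := x0_eq
  rw [hx, cconj_x0]
  refine ⟨gnu_ne_x0, ?_, ?_, ?_, ?_, ?_, ?_⟩
  · exact (Matrix.isUnit_iff_isUnit_det _).mpr (isUnit_iff_ne_zero.mpr gA_det_x0)
  · exact (Matrix.isUnit_iff_isUnit_det _).mpr (Matrix.isUnit_det_of_right_inverse Hhat_mul_x0)
  · exact fun α i j => (MD_x α _ _ gnu_ne_x0 gA_det_x0 i j).differentiableAt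
  · exact fun α i j => (MD_y α _ _ gnu_ne_x0 gA_det_x0 i j).differentiableAt
  · exact fun α β i j => (MD_xy α β _ _ gnu_ne_x0 gA_det_x0 i j).differentiableAt
  · rw [Kmat_x0, Kq_eq]
    ext i j; fin_cases i <;> fin_cases j <;> simp
end
end
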